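/- Let Λ = {Λ_ω ∈ B(H,E) : ω ∈ Ω} be a continuous g-frame for H with respect to E with lower bound A_Λ, and let Θ = {Θ_ω ∈ B(H,E) : ω ∈ Ω} be a continuous g-Bessel family for H with respect to E. Suppose there exists a number λ with 0 < λ < A_Λ such that ‖S_ΘΛ f − S_Λ f‖ ≤ λ‖f‖ for all f ∈ H. Then Λ is a Riesz-type continuous g-frame if and only if Θ is a Riesz-type continuous g-frame. -/

import Mathlib

open MeasureTheory
open scoped ENNReal NNReal Pointwise

noncomputable section

local notation "⟪" x ", " y "⟫" => @inner ℂ _ _ x y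

variable {Ω : Type*} [MeasurableSpace Ω]

section Defs

variable {F G E : Type*}
  [NormedAddCommGroup F] [InnerProductSpace ℂ F]
  [NormedAddCommGroup G] [InnerProductSpace ℂ G]
  [NormedAddCommGroup E] [InnerProductSpace ℂ E]

/-- `Λ` is a continuous g-frame for `F` with respect to `E`, with frame bounds `A`, `B`:
for every `f`, `ω ↦ Λ ω f` is strongly measurable and
`A‖f‖² ≤ ∫ ‖Λ ω f‖² dμ(ω) ≤ B‖f‖²`. -/
def IsCgFrame (μ : Measure Ω) (Λ : Ω → F →L[ℂ] E) (A B : ℝ) : Prop :=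
  (∀ f : F, StronglyMeasurable fun ω => Λ ω f) ∧
    ∀ f : F,
      ENNReal.ofReal (A * ‖f‖ ^ 2) ≤ ∫⁻ ω, (‖Λ ω f‖₊ : ℝ≥0∞) ^ 2 ∂μ ∧
        ∫⁻ ω, (‖Λ ω f‖₊ : ℝ≥0∞) ^ 2 ∂μ ≤ ENNReal.ofReal (B * ‖f‖ ^ 2)

/-- `Λ` is a continuous g-Bessel family with Bessel constant `B`. -/
def IsCgBessel (μ : Measure Ω) (Λ : Ω → F →L[ℂ] E) (B : ℝ) : Prop :=
  (∀ f : F, StronglyMeasurable fun ω => Λ ω f) ∧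
    ∀ f : F, ∫⁻ ω, (‖Λ ω f‖₊ : ℝ≥0∞) ^ 2 ∂μ ≤ ENNReal.ofReal (B * ‖f‖ ^ 2)

/-- `Λ` is a tight continuous g-frame with bound `A`. -/
def IsCgTight (μ : Measure Ω) (Λ : Ω → F →L[ℂ] E) (A : ℝ) : Prop :=
  (∀ f : F, StronglyMeasurable fun ω => Λ ω f) ∧
    ∀ f : F, ∫⁻ ω, (‖Λ ω f‖₊ : ℝ≥0∞) ^ 2 ∂μ = ENNReal.ofReal (A * ‖f‖ ^ 2)

/-- `Λ` is a Parseval continuous g-frame. -/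
def IsCgParseval (μ : Measure Ω) (Λ : Ω → F →L[ℂ] E) : Prop :=
  (∀ f : F, StronglyMeasurable fun ω => Λ ω f) ∧
    ∀ f : F, ∫⁻ ω, (‖Λ ω f‖₊ : ℝ≥0∞) ^ 2 ∂μ = ENNReal.ofReal (‖f‖ ^ 2)

/-- The range of the analysis operator `T*_Λ : F → Ê = L²(Ω,μ;E)`, i.e. the set of elements of
`L²(Ω,μ;E)` represented by `ω ↦ Λ ω f` for some `f : F`. -/
def analysisRange (μ : Measure Ω) (Λ : Ω → F →L[ℂ] E) : Set (Lp E 2 μ) :=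
  {φ | ∃ f : F, (fun ω => Λ ω f) =ᵐ[μ] (φ : Ω → E)}

/-- `Λ` and `Θ` are strongly disjoint: the ranges of their analysis operators are orthogonal,
equivalently `∫ ⟨Λ ω h, Θ ω k⟩ dμ(ω) = 0` for all `h`, `k`. -/
def StronglyDisjoint (μ : Measure Ω) (Λ : Ω → F →L[ℂ] E) (Θ : Ω → G →L[ℂ] E) : Prop :=
  ∀ (h : F) (k : G), ∫ ω, ⟪Λ ω h, Θ ω k⟫ ∂μ = 0

/-- `Λ` and `Θ` are disjoint: `Range T*_Λ ∩ Range T*_Θ = {0}` and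
`Range T*_Λ + Range T*_Θ` is closed in `Ê`. -/
def IsDisjoint (μ : Measure Ω) (Λ : Ω → F →L[ℂ] E) (Θ : Ω → G →L[ℂ] E) : Prop :=
  analysisRange μ Λ ∩ analysisRange μ Θ = {(0 : Lp E 2 μ)} ∧
    IsClosed (analysisRange μ Λ + analysisRange μ Θ)

/-- `Λ` and `Θ` are weakly disjoint: `Range T*_Λ ∩ Range T*_Θ = {0}`. -/
def WeaklyDisjoint (μ : Measure Ω) (Λ : Ω → F →L[ℂ] E) (Θ : Ω → G →L[ℂ] E) : Prop :=
  analysisRange μ Λ ∩ analysisRange μ Θ = {(0 : Lp E 2 μ)}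

/-- `Λ` and `Θ` are a complementary pair: `Range T*_Λ ∩ Range T*_Θ = {0}` and
`Range T*_Λ + Range T*_Θ = Ê`. -/
def ComplementaryPair (μ : Measure Ω) (Λ : Ω → F →L[ℂ] E) (Θ : Ω → G →L[ℂ] E) : Prop :=
  analysisRange μ Λ ∩ analysisRange μ Θ = {(0 : Lp E 2 μ)} ∧
    analysisRange μ Λ + analysisRange μ Θ = (Set.univ : Set (Lp E 2 μ))

/-- `Λ` and `Θ` are a strongly complementary pair: `Ê` is the orthogonal direct sum of
`Range T*_Λ` and `Range T*_Θ`. -/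
def StronglyComplementaryPair (μ : Measure Ω) (Λ : Ω → F →L[ℂ] E) (Θ : Ω → G →L[ℂ] E) : Prop :=
  StronglyDisjoint μ Λ Θ ∧
    analysisRange μ Λ + analysisRange μ Θ = (Set.univ : Set (Lp E 2 μ))

/-- `S` is the (continuous g-)frame operator of `Λ`:
`⟨S f, g⟩ = ∫ ⟨Λ ω f, Λ ω g⟩ dμ(ω)`. -/
def IsFrameOperator (μ : Measure Ω) (Λ : Ω → F →L[ℂ] E) (S : F →L[ℂ] F) : Prop :=
  ∀ f g : F, ⟪S f, g⟫ = ∫ ω, ⟪Λ ω f, Λ ω g⟫ ∂μ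

/-- `Θ` is a dual of `Λ`: `∫ ⟨Θ ω f, Λ ω g⟩ dμ(ω) = ⟨f, g⟩` for all `f`, `g`. -/
def IsDualOf (μ : Measure Ω) (Θ Λ : Ω → F →L[ℂ] E) : Prop :=
  ∀ f g : F, ∫ ω, ⟪Θ ω f, Λ ω g⟫ ∂μ = ⟪f, g⟫

/-- `Λ` is a Riesz-type continuous g-frame: it is a continuous g-frame and every dual of `Λ`
is weakly equal to the canonical dual `{Λ_ω S_Λ⁻¹}`, where `S_Λ` is the frame operator. -/
def IsRieszType (μ : Measure Ω) (Λ : Ω → F →L[ℂ] E) : Prop :=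
  (∃ A B : ℝ, 0 < A ∧ IsCgFrame μ Λ A B) ∧
    ∀ S : F ≃L[ℂ] F, IsFrameOperator μ Λ (S : F →L[ℂ] F) →
      ∀ Θ : Ω → F →L[ℂ] E, (∃ A B : ℝ, 0 < A ∧ IsCgFrame μ Θ A B) → IsDualOf μ Θ Λ →
        ∀ f : F, ∀ᵐ ω ∂μ, Θ ω f = Λ ω (S.symm f)

/-- The operator `h ⊕ k ↦ Λω h + Θω k` on the Hilbert direct sum `F ⊕ G = WithLp 2 (F × G)`. -/
def pairMap (Λω : F →L[ℂ] E) (Θω : G →L[ℂ] E) : WithLp 2 (F × G) →L[ℂ] E :=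
  (Λω.comp (ContinuousLinearMap.fst ℂ F G) + Θω.comp (ContinuousLinearMap.snd ℂ F G)).comp
    (WithLp.prodContinuousLinearEquiv 2 ℂ F G).toContinuousLinearMap

end Defs

variable {H K E : Type*}
  [NormedAddCommGroup H] [InnerProductSpace ℂ H] [CompleteSpace H]
  [NormedAddCommGroup K] [InnerProductSpace ℂ K] [CompleteSpace K]
  [NormedAddCommGroup E] [InnerProductSpace ℂ E] [CompleteSpace E]

/-- `T : H → L²(Ω, μ; E)` is the analysis operator of `Λ`: `T f` is represented by
`ω ↦ Λ ω f`. -/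
def IsAnalysisOp (μ : Measure Ω) (Λ : Ω → H →L[ℂ] E) (T : H →L[ℂ] Lp E 2 μ) : Prop :=
  ∀ f : H, T f =ᵐ[μ] fun ω => Λ ω f

omit [InnerProductSpace ℂ E] [CompleteSpace E] in
theorem MeasureTheory.Lp.lintegral_nnnorm_sq {μ : Measure Ω} (φ : Lp E 2 μ) :
    ∫⁻ ω, (‖φ ω‖₊ : ℝ≥0∞) ^ 2 ∂μ = ENNReal.ofReal (‖φ‖ ^ 2) := by
  rw [ENNReal.ofReal_pow (norm_nonneg _), ofReal_norm, Lp.enorm_def]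
  have h := eLpNorm_nnreal_pow_eq_lintegral (μ := μ) (f := (φ : Ω → E)) (p := 2) two_ne_zero
  simp only [NNReal.coe_ofNat, ENNReal.rpow_ofNat, ENNReal.coe_ofNat] at h
  exact h.symm

omit [CompleteSpace H] [CompleteSpace E] in
/-- Every continuous g-Bessel family has an analysis operator. -/
theorem IsCgBessel.exists_isAnalysisOp {μ : Measure Ω} {Λ : Ω → H →L[ℂ] E} {B : ℝ}
    (h : IsCgBessel μ Λ B) : ∃ T : H →L[ℂ] Lp E 2 μ, IsAnalysisOp μ Λ T := by
  have hmem : ∀ f : H, MemLp (fun ω => Λ ω f) 2 μ := fun f => by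
    refine ⟨(h.1 f).aestronglyMeasurable, ?_⟩
    have h2 := eLpNorm_nnreal_pow_eq_lintegral (μ := μ) (f := fun ω => Λ ω f) (p := 2) two_ne_zero
    simp only [NNReal.coe_ofNat, ENNReal.rpow_ofNat, ENNReal.coe_ofNat] at h2
    have h3 : eLpNorm (fun ω => Λ ω f) 2 μ ^ 2 < ∞ := by
      rw [h2]
      exact (h.2 f).trans_lt ENNReal.ofReal_lt_top
    exact (ENNReal.pow_lt_top_iff.1 h3).resolve_right two_ne_zero
  let T₀ : H →ₗ[ℂ] Lp E 2 μ :=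
    { toFun := fun f => (hmem f).toLp _
      map_add' := fun f g => by
        rw [← MemLp.toLp_add]
        exact MemLp.toLp_congr _ _ (.of_forall fun ω => by simp)
      map_smul' := fun c f => by
        rw [RingHom.id_apply, ← MemLp.toLp_const_smul]
        exact MemLp.toLp_congr _ _ (.of_forall fun ω => by simp) }
  have hT₀ : ∀ f, T₀ f =ᵐ[μ] fun ω => Λ ω f := fun f => (hmem f).coeFn_toLp
  refine ⟨T₀.mkContinuous (√(max B 0)) fun f => ?_, hT₀⟩
  refine le_of_sq_le_sq ?_ (by positivity)
  rw [mul_pow, Real.sq_sqrt (le_max_right _ _)]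
  have hle : ENNReal.ofReal (‖T₀ f‖ ^ 2) ≤ ENNReal.ofReal (max B 0 * ‖f‖ ^ 2) := by
    rw [← Lp.lintegral_nnnorm_sq, lintegral_congr_ae ((hT₀ f).mono fun ω hω => by rw [hω])]
    exact (h.2 f).trans (ENNReal.ofReal_le_ofReal (by gcongr; exact le_max_left _ _))
  exact (ENNReal.ofReal_le_ofReal_iff (by positivity)).1 hle

omit [CompleteSpace H] [CompleteSpace E] in
theorem IsCgFrame.isCgBessel {μ : Measure Ω} {Λ : Ω → H →L[ℂ] E} {A B : ℝ}
    (h : IsCgFrame μ Λ A B) : IsCgBessel μ Λ B :=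
  ⟨h.1, fun f => (h.2 f).2⟩

namespace IsAnalysisOp

variable {μ : Measure Ω} {Λ Θ : Ω → H →L[ℂ] E} {T U : H →L[ℂ] Lp E 2 μ}

omit [CompleteSpace H] [CompleteSpace E] in
theorem integral_inner (hT : IsAnalysisOp μ Λ T) (hU : IsAnalysisOp μ Θ U) (f g : H) :
    ∫ ω, ⟪Λ ω f, Θ ω g⟫ ∂μ = ⟪T f, U g⟫ := by
  rw [L2.inner_def]
  refine integral_congr_ae ?_
  filter_upwards [hT f, hU g] with ω h₁ h₂
  rw [h₁, h₂]

omit [CompleteSpace H] [CompleteSpace E] in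
theorem lintegral_sq (hT : IsAnalysisOp μ Λ T) (f : H) :
    ∫⁻ ω, (‖Λ ω f‖₊ : ℝ≥0∞) ^ 2 ∂μ = ENNReal.ofReal (‖T f‖ ^ 2) := by
  rw [← Lp.lintegral_nnnorm_sq]
  refine lintegral_congr_ae ?_
  filter_upwards [hT f] with ω hω
  rw [hω]

omit [CompleteSpace H] [CompleteSpace E] in
/-- A family whose analysis operator is left invertible is a continuous g-frame. -/
theorem exists_isCgFrame (hT : IsAnalysisOp μ Λ T)
    (hΛ : ∀ f : H, StronglyMeasurable fun ω => Λ ω f) (C : Lp E 2 μ →L[ℂ] H)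
    (hC : ∀ f, C (T f) = f) : ∃ A B : ℝ, 0 < A ∧ IsCgFrame μ Λ A B := by
  refine ⟨((‖C‖ + 1) ^ 2)⁻¹, ‖T‖ ^ 2, by positivity, hΛ, fun f => ?_⟩
  rw [hT.lintegral_sq]
  refine ⟨ENNReal.ofReal_le_ofReal ?_, ENNReal.ofReal_le_ofReal ?_⟩
  · rw [inv_mul_le_iff₀ (by positivity), ← mul_pow]
    gcongr
    calc ‖f‖ = ‖C (T f)‖ := by rw [hC]
      _ ≤ ‖C‖ * ‖T f‖ := C.le_opNorm _
      _ ≤ (‖C‖ + 1) * ‖T f‖ := by gcongr; linarith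
  · rw [← mul_pow]
    gcongr
    exact T.le_opNorm f

omit [CompleteSpace H] [CompleteSpace E] in
theorem sq_le_of_isCgFrame (hT : IsAnalysisOp μ Λ T) {A B : ℝ} (h : IsCgFrame μ Λ A B) (f : H) :
    A * ‖f‖ ^ 2 ≤ ‖T f‖ ^ 2 := by
  have := (h.2 f).1
  rw [hT.lintegral_sq] at this
  exact (ENNReal.ofReal_le_ofReal_iff (by positivity)).1 this

omit [CompleteSpace H] [CompleteSpace E] in
theorem isFrameOperator_iff (hT : IsAnalysisOp μ Λ T) (S : H →L[ℂ] H) :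
    IsFrameOperator μ Λ S ↔ ∀ f g, ⟪S f, g⟫ = ⟪T f, T g⟫ := by
  simp only [IsFrameOperator, hT.integral_inner hT]

end IsAnalysisOp

/-- A coercive operator on a Hilbert space is invertible. -/
theorem exists_equiv_of_coercive (V : H →L[ℂ] H) {c : ℝ} (hc : 0 < c)
    (h : ∀ f, c * ‖f‖ ^ 2 ≤ (⟪V f, f⟫).re) : ∃ e : H ≃L[ℂ] H, ∀ f, e f = V f := by
  have hu : IsUnit V :=
    ContinuousLinearMap.isUnit_of_forall_le_norm_inner_map V (c := ⟨c, hc.le⟩) hc fun f => by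
      rw [mul_comm]
      exact (h f).trans (Complex.re_le_norm _)
  obtain ⟨u, rfl⟩ := hu
  exact ⟨ContinuousLinearEquiv.unitsEquiv ℂ H u, fun f => rfl⟩

theorem IsAnalysisOp.exists_frameOperator {μ : Measure Ω} {Λ : Ω → H →L[ℂ] E}
    {T : H →L[ℂ] Lp E 2 μ} (hT : IsAnalysisOp μ Λ T) {A B : ℝ} (hA : 0 < A)
    (h : IsCgFrame μ Λ A B) : ∃ S : H ≃L[ℂ] H, IsFrameOperator μ Λ (S : H →L[ℂ] H) := by
  obtain ⟨e, he⟩ := exists_equiv_of_coercive (T.adjoint ∘L T) hA fun f => by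
    rw [ContinuousLinearMap.comp_apply, ContinuousLinearMap.adjoint_inner_left,
      inner_self_eq_norm_sq_to_K]
    have := hT.sq_le_of_isCgFrame h f
    norm_cast
  refine ⟨e, (hT.isFrameOperator_iff _).2 fun f g => ?_⟩
  rw [ContinuousLinearEquiv.coe_coe, he, ContinuousLinearMap.comp_apply,
    ContinuousLinearMap.adjoint_inner_left]

/-- A continuous g-frame is Riesz-type iff its synthesis operator, the adjoint of the analysis
operator, is injective. -/
theorem IsAnalysisOp.isRieszType_iff [Nontrivial H] {μ : Measure Ω} {Λ : Ω → H →L[ℂ] E}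
    {T : H →L[ℂ] Lp E 2 μ} (hT : IsAnalysisOp μ Λ T)
    (h : ∃ A B : ℝ, 0 < A ∧ IsCgFrame μ Λ A B) :
    IsRieszType μ Λ ↔ ∀ φ : Lp E 2 μ, T.adjoint φ = 0 → φ = 0 := by
  constructor
  · rintro ⟨-, hR⟩ φ hφ
    obtain ⟨A, B, hA, hΛ⟩ := h
    obtain ⟨S, hS⟩ := hT.exists_frameOperator hA hΛ
    have hS' := (hT.isFrameOperator_iff _).1 hS
    obtain ⟨e, he⟩ := exists_ne (0 : H)
    have hφT : ∀ g, ⟪φ, T g⟫ = 0 := fun g => by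
      rw [← ContinuousLinearMap.adjoint_inner_left, hφ, inner_zero_left]
    let Θ : Ω → H →L[ℂ] E := fun ω =>
      Λ ω ∘L (S.symm : H →L[ℂ] H) + (innerSL ℂ e).smulRight (φ ω)
    let U : H →L[ℂ] Lp E 2 μ :=
      T ∘L (S.symm : H →L[ℂ] H) + (innerSL ℂ e).smulRight φ
    have hU : IsAnalysisOp μ Θ U := fun f => by
      filter_upwards [hT (S.symm f), Lp.coeFn_add (T (S.symm f)) (⟪e, f⟫ • φ),
        Lp.coeFn_smul ⟪e, f⟫ φ] with ω h₁ h₂ h₃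
      change (T (S.symm f) + ⟪e, f⟫ • φ : Lp E 2 μ) ω = Λ ω (S.symm f) + ⟪e, f⟫ • φ ω
      rw [h₂, Pi.add_apply, h₁, h₃, Pi.smul_apply]
    have hUT : ∀ f g, ⟪U f, T g⟫ = ⟪f, g⟫ := fun f g => by
      change ⟪T (S.symm f) + ⟪e, f⟫ • φ, T g⟫ = ⟪f, g⟫
      rw [inner_add_left, inner_smul_left, hφT, mul_zero, add_zero, ← hS']
      simp
    have hframe : ∃ A B : ℝ, 0 < A ∧ IsCgFrame μ Θ A B := by
      refine hU.exists_isCgFrame (fun f => ?_) T.adjoint fun f => ?_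
      · exact (hΛ.1 (S.symm f)).add ((Lp.stronglyMeasurable φ).const_smul ⟪e, f⟫)
      · exact ext_inner_right ℂ fun g => by
          rw [ContinuousLinearMap.adjoint_inner_left, hUT]
    have hdual : IsDualOf μ Θ Λ := fun f g => by rw [hU.integral_inner hT, hUT]
    have hae := hR S hS Θ hframe hdual e
    refine Lp.ext ?_
    filter_upwards [hae, Lp.coeFn_zero E 2 μ] with ω hω h₀
    have hz : ⟪e, e⟫ • φ ω = 0 := by
      change Λ ω (S.symm e) + ⟪e, e⟫ • φ ω = Λ ω (S.symm e) at hω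
      exact add_eq_left.1 hω
    rw [h₀, Pi.zero_apply]
    exact (smul_eq_zero.1 hz).resolve_left (inner_self_ne_zero.2 he)
  · intro hinj
    refine ⟨h, fun S hS Θ ⟨A, B, _, hΘ⟩ hdual f => ?_⟩
    obtain ⟨U, hU⟩ := hΘ.isCgBessel.exists_isAnalysisOp
    have hS' := (hT.isFrameOperator_iff _).1 hS
    have h0 : U f - T (S.symm f) = 0 := hinj _ <| ext_inner_right ℂ fun g => by
      rw [ContinuousLinearMap.adjoint_inner_left, inner_sub_left, ← hS',
        ← hU.integral_inner hT, hdual]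
      simp
    filter_upwards [hU f, hT (S.symm f)] with ω h₁ h₂
    rw [← h₁, ← h₂, sub_eq_zero.1 h0]

/-- If `Q₁ T` is surjective, `Q₂ T` is injective and `Q₁` is injective, then so is `Q₂`. -/
theorem eq_zero_of_comp_surjective {X Y : Type*} [AddCommGroup X] [Module ℂ X]
    [AddCommGroup Y] [Module ℂ Y] (T : X →ₗ[ℂ] Y) (Q₁ Q₂ : Y →ₗ[ℂ] X)
    (h₁ : ∀ x, ∃ y, Q₁ (T y) = x) (h₂ : ∀ x, Q₂ (T x) = 0 → x = 0)
    (hQ₁ : ∀ φ, Q₁ φ = 0 → φ = 0) (φ : Y) (hφ : Q₂ φ = 0) : φ = 0 := by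
  obtain ⟨y, hy⟩ := h₁ (Q₁ φ)
  have hφy : φ = T y := sub_eq_zero.1 (hQ₁ _ (by rw [map_sub, hy, sub_self]))
  rw [hφy, h₂ y (hφy ▸ hφ), map_zero]

omit [CompleteSpace H] [CompleteSpace E] in
theorem isRieszType_of_subsingleton [Subsingleton H] {μ : Measure Ω} {Λ : Ω → H →L[ℂ] E}
    (h : ∃ A B : ℝ, 0 < A ∧ IsCgFrame μ Λ A B) : IsRieszType μ Λ :=
  ⟨h, fun S _ Θ _ _ f => .of_forall fun ω => by
    rw [Subsingleton.elim f 0, map_zero, map_zero, map_zero]⟩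

/-- if `Λ` is a continuous g-frame with lower bound `A_Λ`, `Θ` is a continuous
g-Bessel family, and `‖S_ΘΛ f − S_Λ f‖ ≤ λ‖f‖` for some `0 < λ < A_Λ`, then `Λ` is Riesz-type
iff `Θ` is Riesz-type. -/
theorem stmt19 (μ : Measure Ω) (Λ Θ : Ω → H →L[ℂ] E)
    (AL BL BT : ℝ) (hAL : 0 < AL) (hBT : 0 < BT)
    (hL : IsCgFrame μ Λ AL BL) (hT : IsCgBessel μ Θ BT)
    (S : H ≃L[ℂ] H) (hS : IsFrameOperator μ Λ (S : H →L[ℂ] H))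
    (STL : H →L[ℂ] H)
    (hSTL : ∀ f g : H, ⟪STL f, g⟫ = ∫ ω, ⟪Λ ω f, Θ ω g⟫ ∂μ)
    (lam : ℝ) (hlam0 : 0 < lam) (hlamA : lam < AL)
    (hclose : ∀ f : H, ‖STL f - (S : H →L[ℂ] H) f‖ ≤ lam * ‖f‖) :
    IsRieszType μ Λ ↔ IsRieszType μ Θ := by
  obtain ⟨T, hTΛ⟩ := hL.isCgBessel.exists_isAnalysisOp
  obtain ⟨U, hUΘ⟩ := hT.exists_isAnalysisOp
  have hST : ∀ f g, ⟪S f, g⟫ = ⟪T f, T g⟫ := (hTΛ.isFrameOperator_iff _).1 hS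
  have hSTU : ∀ f g, ⟪STL f, g⟫ = ⟪T f, U g⟫ := fun f g => by
    rw [hSTL, hTΛ.integral_inner hUΘ]
  have hTT : ∀ f, T.adjoint (T f) = S f := fun f => ext_inner_right ℂ fun g => by
    rw [ContinuousLinearMap.adjoint_inner_left, hST]
  obtain ⟨e, he⟩ := exists_equiv_of_coercive STL (sub_pos.2 hlamA) fun f => by
    have h₁ : AL * ‖f‖ ^ 2 ≤ (⟪S f, f⟫).re := by
      rw [hST, inner_self_eq_norm_sq_to_K]
      have := hTΛ.sq_le_of_isCgFrame hL f
      norm_cast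
    have h₂ : ‖⟪STL f - S f, f⟫‖ ≤ lam * ‖f‖ ^ 2 :=
      (norm_inner_le_norm _ _).trans <| by
        rw [pow_two, ← mul_assoc]
        gcongr
        exact hclose f
    have h₃ := (abs_le.1 ((Complex.abs_re_le_norm _).trans h₂)).1
    rw [inner_sub_left, Complex.sub_re] at h₃
    linarith
  have hUT : ∀ f, U.adjoint (T f) = e f := fun f => ext_inner_right ℂ fun g => by
    rw [ContinuousLinearMap.adjoint_inner_left, he, hSTU]
  have hΘ : ∃ A B : ℝ, 0 < A ∧ IsCgFrame μ Θ A B := by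
    refine hUΘ.exists_isCgFrame hT.1
      ((e.symm : H →L[ℂ] H).adjoint ∘L T.adjoint) fun f => ext_inner_left ℂ fun g => ?_
    rw [ContinuousLinearMap.comp_apply, ContinuousLinearMap.adjoint_inner_right,
      ContinuousLinearMap.adjoint_inner_right, ← hSTU, ← he]
    simp
  have hΛ : ∃ A B : ℝ, 0 < A ∧ IsCgFrame μ Λ A B := ⟨AL, BL, hAL, hL⟩
  cases subsingleton_or_nontrivial H
  · exact iff_of_true (isRieszType_of_subsingleton hΛ) (isRieszType_of_subsingleton hΘ)
  rw [hTΛ.isRieszType_iff hΛ, hUΘ.isRieszType_iff hΘ]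
  have hT_surj : ∀ x, ∃ y, T.adjoint (T y) = x := fun x => ⟨S.symm x, by simp [hTT]⟩
  have hU_surj : ∀ x, ∃ y, U.adjoint (T y) = x := fun x => ⟨e.symm x, by simp [hUT]⟩
  have hT_inj : ∀ x, T.adjoint (T x) = 0 → x = 0 := fun x hx => by simpa [hTT] using hx
  have hU_inj : ∀ x, U.adjoint (T x) = 0 → x = 0 := fun x hx => by simpa [hUT] using hx
  exact ⟨eq_zero_of_comp_surjective T.toLinearMap T.adjoint.toLinearMap U.adjoint.toLinearMap
      hT_surj hU_inj,
    eq_zero_of_comp_surjective T.toLinearMap U.adjoint.toLinearMap T.adjoint.toLinearMap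
      hU_surj hT_inj⟩
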